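/- Let A be a unital involutive quantale and M an object of mreg-HMOD_A (respectively mreg-Hilb_A). Then M is weakly projective if and only if M is a retract of a free Hilbert A-module A^J, i.e. there exist morphisms i : M → A^J and r : A^J → M with r∘i = id_M. -/

import Mathlib

universe u v w

set_option autoImplicit false

/-- An involutive quantale: a complete lattice with an associative multiplication
distributing over arbitrary joins in both arguments, together with an involution. -/
class InvQuantale (A : Type u) extends CompleteLattice A, Mul A, Star A where
  qmul_assoc : ∀ a b c : A, a * b * c = a * (b * c)
  mul_sSup : ∀ (a : A) (S : Set A), a * sSup S = ⨆ b ∈ S, a * b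
  sSup_mul : ∀ (S : Set A) (a : A), sSup S * a = ⨆ b ∈ S, b * a
  qstar_star : ∀ a : A, star (star a) = a
  star_sSup : ∀ S : Set A, star (sSup S) = ⨆ a ∈ S, star a
  qstar_mul : ∀ a b : A, star (a * b) = star b * star a

namespace Quantale

variable {A : Type u} [InvQuantale A]

theorem mul_iSup {ι : Sort w} (a : A) (f : ι → A) :
    (a * ⨆ i, f i) = ⨆ i, a * f i := by
  rw [iSup, InvQuantale.mul_sSup, iSup_range]

theorem iSup_mul {ι : Sort w} (f : ι → A) (a : A) :
    (⨆ i, f i) * a = ⨆ i, f i * a := by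
  rw [iSup, InvQuantale.sSup_mul, iSup_range]

theorem star_iSup {ι : Sort w} (f : ι → A) :
    star (⨆ i, f i) = ⨆ i, star (f i) := by
  rw [iSup, InvQuantale.star_sSup, iSup_range]

end Quantale

/-- A quantale is unital if it has a two-sided unit for the multiplication. -/
def InvQuantale.IsUnital (A : Type u) [InvQuantale A] : Prop :=
  ∃ e : A, ∀ a : A, e * a = a ∧ a * e = a
section Modules

/-- A right module over an involutive quantale. -/
class QMod (A : Type u) [InvQuantale A] (M : Type v) [CompleteLattice M] where
  act : M → A → M
  act_mul : ∀ (m : M) (a b : A), act m (a * b) = act (act m a) b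
  sSup_act : ∀ (S : Set M) (a : A), act (sSup S) a = ⨆ m ∈ S, act m a
  act_sSup : ∀ (m : M) (S : Set A), act m (sSup S) = ⨆ a ∈ S, act m a

/-- The module action `m ⋄ a`. -/
abbrev qact {A : Type u} [InvQuantale A] {M : Type v} [CompleteLattice M] [QMod A M]
    (m : M) (a : A) : M := QMod.act m a

/-- A right pre-Hilbert module over an involutive quantale. -/
class QPreHilb (A : Type u) [InvQuantale A] (M : Type v) [CompleteLattice M] extends
    QMod A M where
  ip : M → M → A
  ip_mul : ∀ (m n : M) (a : A), ip m n * a = ip m (act n a)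
  sSup_ip : ∀ (S : Set M) (n : M), ip (sSup S) n = ⨆ m ∈ S, ip m n
  ip_sSup : ∀ (m : M) (S : Set M), ip m (sSup S) = ⨆ n ∈ S, ip m n
  star_ip : ∀ m n : M, star (ip m n) = ip n m

/-- The inner product `⟨m, n⟩` with values in `A`. -/
abbrev qip (A : Type u) [InvQuantale A] {M : Type v} [CompleteLattice M] [QPreHilb A M]
    (m n : M) : A := QPreHilb.ip m n

/-- A right Hilbert module: a pre-Hilbert module whose inner product separates points. -/
class QHilb (A : Type u) [InvQuantale A] (M : Type v) [CompleteLattice M] extends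
    QPreHilb A M where
  ip_sep : ∀ m n : M, (∀ p : M, ip p m = ip p n) → m = n

variable {A : Type u} [InvQuantale A]

theorem qact_iSup_left {M : Type v} [CompleteLattice M] [QMod A M] {ι : Sort w}
    (f : ι → M) (a : A) : qact (⨆ i, f i) a = ⨆ i, qact (f i) a := by
  rw [iSup]; exact (QMod.sSup_act _ _).trans iSup_range

theorem qact_iSup_right {M : Type v} [CompleteLattice M] [QMod A M] {ι : Sort w}
    (m : M) (f : ι → A) : qact m (⨆ i, f i) = ⨆ i, qact m (f i) := by
  rw [iSup]; exact (QMod.act_sSup _ _).trans iSup_range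

theorem qip_iSup_left {M : Type v} [CompleteLattice M] [QPreHilb A M] {ι : Sort w}
    (f : ι → M) (n : M) : qip A (⨆ i, f i) n = ⨆ i, qip A (f i) n := by
  rw [iSup]; exact (QPreHilb.sSup_ip _ _).trans iSup_range

theorem qip_iSup_right {M : Type v} [CompleteLattice M] [QPreHilb A M] {ι : Sort w}
    (m : M) (f : ι → M) : qip A m (⨆ i, f i) = ⨆ i, qip A m (f i) := by
  rw [iSup]; exact (QPreHilb.ip_sSup _ _).trans iSup_range

/-- A module is essential if every element is a join of elements of the form `m ⋄ a`. -/
def Essential (A : Type u) [InvQuantale A] (M : Type v) [CompleteLattice M] [QMod A M] :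
    Prop :=
  ∀ m : M, m = sSup {x : M | (∃ (p : M) (a : A), x = qact p a) ∧ x ≤ m}

/-- A module is separated by `A` if the right actions separate points. -/
def Separated (A : Type u) [InvQuantale A] (M : Type v) [CompleteLattice M] [QMod A M] :
    Prop :=
  ∀ m n : M, (∀ a : A, qact m a = qact n a) → m = n

/-- A module is m-regular if it is essential and separated. -/
def MRegMod (A : Type u) [InvQuantale A] (M : Type v) [CompleteLattice M] [QMod A M] :
    Prop :=
  Essential A M ∧ Separated A M

/-- A pre-Hilbert module is full if every element of `A` is a join of inner products. -/
def FullMod (A : Type u) [InvQuantale A] (M : Type v) [CompleteLattice M] [QPreHilb A M] :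
    Prop :=
  ∀ a : A, a = sSup {b : A | (∃ m n : M, b = qip A m n) ∧ b ≤ a}

/-- An involutive quantale with multiplication as right action on itself. -/
instance selfQMod : QMod A A where
  act m a := m * a
  act_mul m a b := (InvQuantale.qmul_assoc m a b).symm
  sSup_act S a := InvQuantale.sSup_mul S a
  act_sSup m S := InvQuantale.mul_sSup m S

/-- An involutive quantale as a pre-Hilbert module over itself, with `⟨a, b⟩ = a⋆ · b`. -/
instance selfQPreHilb : QPreHilb A A where
  ip a b := star a * b
  ip_mul m n a := InvQuantale.qmul_assoc _ _ _
  sSup_ip S n := by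
    show star (sSup S) * n = ⨆ m ∈ S, star m * n
    rw [InvQuantale.star_sSup]
    simp only [Quantale.iSup_mul]
  ip_sSup m S := InvQuantale.mul_sSup _ S
  star_ip m n := by
    rw [InvQuantale.qstar_mul, InvQuantale.qstar_star]

/-- An involutive quantale is m-regular if it is m-regular as a right module over itself. -/
def InvQuantale.MReg (A : Type u) [InvQuantale A] : Prop := MRegMod A A

/-- If right multiplications separate the points of `A`, then `A` is a right Hilbert module
over itself. -/
def selfQHilb (hsep : ∀ a b : A, (∀ c : A, a * c = b * c) → a = b) : QHilb A A where
  toQPreHilb := selfQPreHilb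
  ip_sep := by
    intro m n h
    have h2 : ∀ c : A, star m * c = star n * c := by
      intro c
      have h1 : star c * m = star c * n := h c
      have h3 := congrArg star h1
      rw [InvQuantale.qstar_mul, InvQuantale.qstar_mul, InvQuantale.qstar_star] at h3
      exact h3
    have h4 := hsep _ _ h2
    have h5 := congrArg star h4
    rwa [InvQuantale.qstar_star, InvQuantale.qstar_star] at h5

end Modules
section Pi

variable {A : Type u} [InvQuantale A]

/-- Pointwise right module structure on a power of a module. -/
instance piQMod (J : Type w) (M : Type v) [CompleteLattice M] [QMod A M] :
    QMod A (J → M) where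
  act v a := fun j => qact (v j) a
  act_mul v a b := funext fun j => QMod.act_mul (v j) a b
  sSup_act S a := by
    funext j
    show qact (sSup S j) a = _
    rw [sSup_apply, qact_iSup_left, iSup_subtype]
    simp only [iSup_apply]
  act_sSup v S := by
    funext j
    show qact (v j) (sSup S) = _
    rw [show qact (v j) (sSup S) = ⨆ a ∈ S, qact (v j) a from QMod.act_sSup _ _]
    simp only [iSup_apply]

/-- Pointwise pre-Hilbert structure on a power of a pre-Hilbert module, with inner product
`⟨v, w⟩ = ⨆ j, ⟨v j, w j⟩`.  In particular `A^J` carries the inner product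
`⟨(a_j), (b_j)⟩ = ⨆ j, a_j⋆ · b_j`. -/
instance piQPreHilb (J : Type w) (M : Type v) [CompleteLattice M] [QPreHilb A M] :
    QPreHilb A (J → M) where
  ip v w := ⨆ j, qip A (v j) (w j)
  ip_mul v w a := by
    show (⨆ j, qip A (v j) (w j)) * a = ⨆ j, qip A (v j) (qact (w j) a)
    rw [Quantale.iSup_mul]
    exact iSup_congr fun j => QPreHilb.ip_mul _ _ _
  sSup_ip S w := by
    show (⨆ j, qip A (sSup S j) (w j)) = ⨆ v ∈ S, ⨆ j, qip A (v j) (w j)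
    calc (⨆ j, qip A (sSup S j) (w j))
        = ⨆ j, ⨆ f : S, qip A ((f : J → M) j) (w j) := by
          refine iSup_congr fun j => ?_
          rw [sSup_apply, qip_iSup_left]
      _ = ⨆ f : S, ⨆ j, qip A ((f : J → M) j) (w j) := iSup_comm
      _ = ⨆ v ∈ S, ⨆ j, qip A (v j) (w j) := by rw [iSup_subtype]
  ip_sSup v S := by
    show (⨆ j, qip A (v j) (sSup S j)) = ⨆ w ∈ S, ⨆ j, qip A (v j) (w j)
    calc (⨆ j, qip A (v j) (sSup S j))
        = ⨆ j, ⨆ f : S, qip A (v j) ((f : J → M) j) := by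
          refine iSup_congr fun j => ?_
          rw [sSup_apply, qip_iSup_right]
      _ = ⨆ f : S, ⨆ j, qip A (v j) ((f : J → M) j) := iSup_comm
      _ = ⨆ w ∈ S, ⨆ j, qip A (v j) (w j) := by rw [iSup_subtype]
  star_ip v w := by
    show star (⨆ j, qip A (v j) (w j)) = ⨆ j, qip A (w j) (v j)
    rw [Quantale.star_iSup]
    exact iSup_congr fun j => QPreHilb.star_ip _ _

end Pi

section Maps

variable {A : Type u} [InvQuantale A]

/-- A module homomorphism: a join-preserving map commuting with the action. -/
def IsModHom (A : Type u) [InvQuantale A] {M : Type v} {N : Type w}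
    [CompleteLattice M] [CompleteLattice N] [QMod A M] [QMod A N] (f : M → N) : Prop :=
  (∀ S : Set M, f (sSup S) = ⨆ m ∈ S, f m) ∧ ∀ (m : M) (a : A), f (qact m a) = qact (f m) a

/-- `g` is a ⋆-adjoint of `f`: `⟨f m, n⟩ = ⟨m, g n⟩`. -/
def IsAdjointPair (A : Type u) [InvQuantale A] {M : Type v} {N : Type w}
    [CompleteLattice M] [CompleteLattice N] [QPreHilb A M] [QPreHilb A N]
    (f : M → N) (g : N → M) : Prop :=
  ∀ (m : M) (n : N), qip A (f m) n = qip A m (g n)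

/-- A map between (pre-)Hilbert modules is adjointable if it has a ⋆-adjoint. -/
def Adjointable (A : Type u) [InvQuantale A] {M : Type v} {N : Type w}
    [CompleteLattice M] [CompleteLattice N] [QPreHilb A M] [QPreHilb A N]
    (f : M → N) : Prop :=
  ∃ g : N → M, IsAdjointPair A f g

theorem IsAdjointPair.symm' {M : Type v} {N : Type w}
    [CompleteLattice M] [CompleteLattice N] [QPreHilb A M] [QPreHilb A N]
    {f : M → N} {g : N → M} (h : IsAdjointPair A f g) : IsAdjointPair A g f := by
  intro n m
  calc qip A (g n) m = star (qip A m (g n)) := (QPreHilb.star_ip m (g n)).symm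
    _ = star (qip A (f m) n) := by rw [h m n]
    _ = qip A n (f m) := QPreHilb.star_ip _ _

/-- The rank-one operator `Θ_{n,m} : x ↦ n ⋄ ⟨m, x⟩`. -/
def theta (A : Type u) [InvQuantale A] {M : Type v} {N : Type w}
    [CompleteLattice M] [CompleteLattice N] [QPreHilb A M] [QPreHilb A N]
    (n : N) (m : M) : M → N :=
  fun x => qact n (qip A m x)

/-- A compact operator: an arbitrary (pointwise) join of rank-one operators `Θ_{n,m}`. -/
def IsCompactOp (A : Type u) [InvQuantale A] {M : Type v} {N : Type w}
    [CompleteLattice M] [CompleteLattice N] [QPreHilb A M] [QPreHilb A N]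
    (f : M → N) : Prop :=
  ∃ S : Set (N × M), ∀ x : M, f x = ⨆ p ∈ S, theta A p.1 p.2 x

end Maps

section LeftModules

/-- A left module over an involutive quantale. -/
class QLMod (A : Type u) [InvQuantale A] (M : Type v) [CompleteLattice M] where
  lact : A → M → M
  lact_mul : ∀ (a b : A) (m : M), lact (a * b) m = lact a (lact b m)
  sSup_lact : ∀ (S : Set A) (m : M), lact (sSup S) m = ⨆ a ∈ S, lact a m
  lact_sSup : ∀ (a : A) (S : Set M), lact a (sSup S) = ⨆ m ∈ S, lact a m

/-- A left pre-Hilbert module over an involutive quantale. -/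
class QLPreHilb (A : Type u) [InvQuantale A] (M : Type v) [CompleteLattice M] extends
    QLMod A M where
  lip : M → M → A
  lip_lact : ∀ (a : A) (m n : M), a * lip m n = lip (lact a m) n
  sSup_lip : ∀ (S : Set M) (n : M), lip (sSup S) n = ⨆ m ∈ S, lip m n
  lip_sSup : ∀ (m : M) (S : Set M), lip m (sSup S) = ⨆ n ∈ S, lip m n
  star_lip : ∀ m n : M, star (lip m n) = lip n m

/-- A left Hilbert module. -/
class QLHilb (A : Type u) [InvQuantale A] (M : Type v) [CompleteLattice M] extends
    QLPreHilb A M where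
  lip_sep : ∀ m n : M, (∀ p : M, lip m p = lip n p) → m = n

/-- A left module is essential if every element is a join of elements `a • m`. -/
def LEssential (A : Type u) [InvQuantale A] (M : Type v) [CompleteLattice M] [QLMod A M] :
    Prop :=
  ∀ m : M, m = sSup {x : M | (∃ (a : A) (p : M), x = QLMod.lact a p) ∧ x ≤ m}

/-- A left module is separated by `A` if the left actions separate points. -/
def LSeparated (A : Type u) [InvQuantale A] (M : Type v) [CompleteLattice M] [QLMod A M] :
    Prop :=
  ∀ m n : M, (∀ a : A, QLMod.lact a m = QLMod.lact a n) → m = n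

/-- A left pre-Hilbert module is full if every element of `A` is a join of inner products. -/
def LFull (A : Type u) [InvQuantale A] (M : Type v) [CompleteLattice M] [QLPreHilb A M] :
    Prop :=
  ∀ a : A, a = sSup {b : A | (∃ m n : M, b = QLPreHilb.lip m n) ∧ b ≤ a}

end LeftModules
open CategoryTheory

section Categories

variable {A : Type u} [InvQuantale A]

/-- An object of the category `mreg-Hilb_A` (or `mreg-HMOD_A`): an m-regular right
Hilbert `A`-module. -/
structure HObj (A : Type u) [InvQuantale A] : Type (u + 1) where
  carrier : Type u
  [lat : CompleteLattice carrier]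
  [str : QHilb A carrier]
  ess : Essential A carrier
  sep : Separated A carrier

attribute [instance] HObj.lat HObj.str

instance : CoeSort (HObj A) (Type u) := ⟨HObj.carrier⟩

/-- The category `mreg-Hilb_A` of m-regular right Hilbert `A`-modules with
adjointable maps as morphisms. -/
instance HObj.cat : Category.{u} (HObj A) where
  Hom M N := {f : M.carrier → N.carrier // Adjointable A f}
  id M := ⟨fun m => m, ⟨fun m => m, fun _ _ => rfl⟩⟩
  comp {M N P} f g := ⟨fun m => g.1 (f.1 m), by
    obtain ⟨f', hf⟩ := f.2
    obtain ⟨g', hg⟩ := g.2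
    exact ⟨fun p => f' (g' p), fun m p => (hg (f.1 m) p).trans (hf m (g' p))⟩⟩
  id_comp f := Subtype.ext rfl
  comp_id f := Subtype.ext rfl
  assoc f g h := Subtype.ext rfl

/-- Construct a morphism of `mreg-Hilb_A`. -/
def mkHom {M N : HObj A} (f : M.carrier → N.carrier) (hf : Adjointable A f) : M ⟶ N :=
  ⟨f, hf⟩

/-- The underlying function of a morphism. -/
def homFn {M N : HObj A} (f : M ⟶ N) : M.carrier → N.carrier := f.1

/-- The ⋆-adjoint of a morphism of `mreg-Hilb_A`. -/
noncomputable def hStar {M N : HObj A} (f : M ⟶ N) : N ⟶ M :=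
  ⟨Classical.choose f.2, ⟨f.1, (Classical.choose_spec f.2).symm'⟩⟩

theorem hStar_adj {M N : HObj A} (f : M ⟶ N) : IsAdjointPair A f.1 (hStar f).1 :=
  Classical.choose_spec f.2

/-- The join of a set of morphisms of `mreg-Hilb_A`, computed pointwise. -/
noncomputable def hSup {M N : HObj A} (S : Set (M ⟶ N)) : M ⟶ N :=
  ⟨fun m => ⨆ f ∈ S, (f : M ⟶ N).1 m,
   ⟨fun n => ⨆ f ∈ S, (hStar f).1 n, by
      intro m n
      have L : qip A (⨆ f ∈ S, (f : M ⟶ N).1 m) n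
          = ⨆ f ∈ S, qip A ((f : M ⟶ N).1 m) n := by
        rw [qip_iSup_left]
        exact iSup_congr fun f => qip_iSup_left _ _
      have R : qip A m (⨆ f ∈ S, (hStar f).1 n)
          = ⨆ f ∈ S, qip A m ((hStar f).1 n) := by
        rw [qip_iSup_right]
        exact iSup_congr fun f => qip_iSup_right _ _
      rw [L, R]
      exact iSup_congr fun f => iSup_congr fun _ => hStar_adj f m n⟩⟩

/-- A morphism is unitary if its ⋆-adjoint is a two-sided inverse. -/
noncomputable def IsUnitaryHom {M N : HObj A} (f : M ⟶ N) : Prop :=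
  f ≫ hStar f = 𝟙 M ∧ hStar f ≫ f = 𝟙 N

end Categories

section Functors

/-- A (join-preserving) ⋆-functor between the categories `mreg-Hilb_A` and `mreg-Hilb_B`. -/
structure StarFunctor (A B : Type u) [InvQuantale A] [InvQuantale B] : Type (u + 1) where
  toFunctor : HObj A ⥤ HObj B
  map_star : ∀ {M N : HObj A} (f : M ⟶ N),
    toFunctor.map (hStar f) = hStar (toFunctor.map f)
  map_hSup : ∀ {M N : HObj A} (S : Set (M ⟶ N)),
    toFunctor.map (hSup S) = hSup (toFunctor.map '' S)

/-- Morita equivalence of involutive quantales: there are ⋆-functors `F, G` between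
`mreg-Hilb_A` and `mreg-Hilb_B` with `GF ≅ Id` and `FG ≅ Id` via unitary natural
isomorphisms. -/
def Morita (A B : Type u) [InvQuantale A] [InvQuantale B] : Prop :=
  ∃ (F : StarFunctor A B) (G : StarFunctor B A)
    (η : F.toFunctor ⋙ G.toFunctor ⟶ 𝟭 (HObj A))
    (ζ : G.toFunctor ⋙ F.toFunctor ⟶ 𝟭 (HObj B)),
    (∀ M : HObj A, IsUnitaryHom (η.app M)) ∧ (∀ N : HObj B, IsUnitaryHom (ζ.app N))

variable {A : Type u} [InvQuantale A]

/-- An m-regular involutive quantale as an object of `mreg-Hilb_A`. -/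
def selfObj (A : Type u) [InvQuantale A] (hA : InvQuantale.MReg A) : HObj A where
  carrier := A
  lat := inferInstance
  str := selfQHilb hA.2
  ess := hA.1
  sep := hA.2

/-- Left multiplication by `a` as a morphism `A ⟶ A` of `mreg-Hilb_A`. -/
def lmulHom (A : Type u) [InvQuantale A] (hA : InvQuantale.MReg A) (a : A) :
    selfObj A hA ⟶ selfObj A hA :=
  ⟨fun (b : A) => a * b, ⟨fun (b : A) => Star.star a * b, fun (m n : A) => by
    show Star.star (a * m) * n = Star.star m * (Star.star a * n)
    rw [InvQuantale.qstar_mul, InvQuantale.qmul_assoc]⟩⟩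

/-- The left `A`-action `a • z = F(L_a)(z)` on `Z = F(A)` used in the Eilenberg-Watts
theorem. -/
def EWact {A B : Type u} [InvQuantale A] [InvQuantale B] (hA : InvQuantale.MReg A)
    (F : StarFunctor A B) :
    A → (F.toFunctor.obj (selfObj A hA)).carrier → (F.toFunctor.obj (selfObj A hA)).carrier :=
  fun a z => (F.toFunctor.map (lmulHom A hA a)).1 z

end Functors
section Bimodules

/-- A right Hilbert `A`–`B` bimodule structure: `M` is a right Hilbert `B`-module with a
compatible left `A`-action. -/
structure IsRightHilbBimod (A B : Type u) [InvQuantale A] [InvQuantale B]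
    (M : Type u) [CompleteLattice M] [QHilb B M] (lact : A → M → M) : Prop where
  lact_mul : ∀ (a b : A) (m : M), lact (a * b) m = lact a (lact b m)
  sSup_lact : ∀ (S : Set A) (m : M), lact (sSup S) m = ⨆ a ∈ S, lact a m
  lact_sSup : ∀ (a : A) (S : Set M), lact a (sSup S) = ⨆ m ∈ S, lact a m
  lact_act : ∀ (a : A) (x : M) (b : B), lact a (qact x b) = qact (lact a x) b
  ip_lact : ∀ (a : A) (x y : M), qip B (lact a x) y = qip B x (lact (Star.star a) y)

/-- A left action is essential if every element is a join of elements `a • m`. -/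
def LEssentialAct {A : Type u} {M : Type u} [CompleteLattice M] (lact : A → M → M) : Prop :=
  ∀ m : M, m = sSup {x : M | (∃ (a : A) (p : M), x = lact a p) ∧ x ≤ m}

/-- `t : M × N → P` realizes `P` as the interior tensor product `M ⊗̇_A N` of the right
Hilbert `A`-module `M` with the right Hilbert `A`–`B` bimodule `N` (with left action
`lactN`): `t` is bilinear for joins, its image join-generates `P`, and
`⟨x₁ ⊗ y₁, x₂ ⊗ y₂⟩ = ⟨y₁, ⟨x₁,x₂⟩ • y₂⟩`. -/
structure IsInteriorTensor (A B : Type u) [InvQuantale A] [InvQuantale B]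
    {M : Type u} [CompleteLattice M] [QHilb A M]
    {N : Type u} [CompleteLattice N] [QHilb B N] (lactN : A → N → N)
    {P : Type u} [CompleteLattice P] [QHilb B P]
    (t : M → N → P) : Prop where
  ip_t : ∀ (x₁ x₂ : M) (y₁ y₂ : N),
    qip B (t x₁ y₁) (t x₂ y₂) = qip B y₁ (lactN (qip A x₁ x₂) y₂)
  sSup_t : ∀ (S : Set M) (y : N), t (sSup S) y = ⨆ x ∈ S, t x y
  t_sSup : ∀ (x : M) (S : Set N), t x (sSup S) = ⨆ y ∈ S, t x y
  gen : ∀ p : P, p = sSup {q : P | (∃ x y, q = t x y) ∧ q ≤ p}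

/-- A bundled right Hilbert `A`-module. -/
structure HilbMod (A : Type u) [InvQuantale A] : Type (u + 1) where
  carrier : Type u
  [lat : CompleteLattice carrier]
  [str : QHilb A carrier]

attribute [instance] HilbMod.lat HilbMod.str

/-- A bundled right Hilbert `A`–`B` bimodule. -/
structure BimodObj (A B : Type u) [InvQuantale A] [InvQuantale B] : Type (u + 1) where
  carrier : Type u
  [lat : CompleteLattice carrier]
  [str : QHilb B carrier]
  lact : A → carrier → carrier
  bimod : IsRightHilbBimod A B carrier lact

attribute [instance] BimodObj.lat BimodObj.str

/-- An imprimitivity `A`–`B` bimodule structure on `X`: a full m-regular right Hilbert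
`B`-module and full m-regular left Hilbert `A`-module with compatible structures. -/
structure IsImprim (A B : Type u) [InvQuantale A] [InvQuantale B]
    (X : Type u) [CompleteLattice X] [QHilb B X]
    (lact : A → X → X) (lip : X → X → A) : Prop where
  bimod : IsRightHilbBimod A B X lact
  lip_lact : ∀ (a : A) (x y : X), a * lip x y = lip (lact a x) y
  sSup_lip : ∀ (S : Set X) (y : X), lip (sSup S) y = ⨆ x ∈ S, lip x y
  lip_sSup : ∀ (x : X) (S : Set X), lip x (sSup S) = ⨆ y ∈ S, lip x y
  star_lip : ∀ x y : X, Star.star (lip x y) = lip y x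
  lip_sep : ∀ x y : X, (∀ z : X, lip x z = lip y z) → x = y
  rfull : ∀ b : B, b = sSup {c : B | (∃ x y : X, c = qip B x y) ∧ c ≤ b}
  lfull : ∀ a : A, a = sSup {c : A | (∃ x y : X, c = lip x y) ∧ c ≤ a}
  ress : Essential B X
  rsep : Separated B X
  less : LEssentialAct lact
  lsep : ∀ m n : X, (∀ a : A, lact a m = lact a n) → m = n
  imp1 : ∀ x y z : X, lact (lip x y) z = qact x (qip B y z)
  imp2 : ∀ (x y : X) (b : B), lip (qact x b) y = lip x (qact y (Star.star b))

/-- A bundled imprimitivity `A`–`B` bimodule; `A` and `B` are strongly Morita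
equivalent iff such a bimodule exists. -/
structure ImprimObj (A B : Type u) [InvQuantale A] [InvQuantale B] : Type (u + 1) where
  carrier : Type u
  [lat : CompleteLattice carrier]
  [str : QHilb B carrier]
  lact : A → carrier → carrier
  lip : carrier → carrier → A
  imprim : IsImprim A B carrier lact lip

attribute [instance] ImprimObj.lat ImprimObj.str

end Bimodules

section Constructions

/-- The opposite involutive quantale `A^d`, with multiplication `a ∘ b = b · a`. -/
def InvQuantale.dual (A : Type u) [iq : InvQuantale A] : InvQuantale A :=
  { iq.toCompleteLattice with
    mul := fun a b => b * a
    star := fun a => Star.star a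
    qmul_assoc := fun a b c => (InvQuantale.qmul_assoc c b a).symm
    mul_sSup := fun a S => InvQuantale.sSup_mul S a
    sSup_mul := fun S a => InvQuantale.mul_sSup a S
    qstar_star := fun a => InvQuantale.qstar_star a
    star_sSup := fun S => InvQuantale.star_sSup S
    qstar_mul := fun a b => InvQuantale.qstar_mul b a }

/-- The involutive quantale of `J × J` matrices over `A`, with matrix multiplication
(joins in place of sums) and conjugate-transpose involution. -/
def MatrixQuantale (A : Type u) [InvQuantale A] (J : Type u) :
    InvQuantale (J → J → A) :=
  { (inferInstance : CompleteLattice (J → J → A)) with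
    mul := fun X Y i k => ⨆ j, X i j * Y j k
    star := fun X i j => Star.star (X j i)
    qmul_assoc := by
      intro X Y Z
      funext i l
      show (⨆ k, (⨆ j, X i j * Y j k) * Z k l) = ⨆ j, X i j * ⨆ k, Y j k * Z k l
      calc (⨆ k, (⨆ j, X i j * Y j k) * Z k l)
          = ⨆ k, ⨆ j, (X i j * Y j k) * Z k l := by
            exact iSup_congr fun k => Quantale.iSup_mul _ _
        _ = ⨆ j, ⨆ k, X i j * (Y j k * Z k l) := by
            rw [iSup_comm]
            exact iSup_congr fun j => iSup_congr fun k => InvQuantale.qmul_assoc _ _ _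
        _ = ⨆ j, X i j * ⨆ k, Y j k * Z k l := by
            exact iSup_congr fun j => (Quantale.mul_iSup _ _).symm
    mul_sSup := by
      intro X S
      funext i k
      show (⨆ j, X i j * sSup S j k) = _
      simp only [sSup_apply, iSup_apply, Quantale.mul_iSup]
      rw [iSup_comm]
      rw [iSup_subtype]
      rfl
    sSup_mul := by
      intro S X
      funext i k
      show (⨆ j, sSup S i j * X j k) = _
      simp only [sSup_apply, iSup_apply, Quantale.iSup_mul]
      rw [iSup_comm]
      rw [iSup_subtype]
      rfl
    qstar_star := by
      intro X
      funext i j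
      exact InvQuantale.qstar_star _
    star_sSup := by
      intro S
      funext i j
      show Star.star (sSup S j i) = _
      simp only [sSup_apply, iSup_apply, Quantale.star_iSup]
      rw [iSup_subtype]
    qstar_mul := by
      intro X Y
      funext i l
      show Star.star (⨆ j, X l j * Y j i) = ⨆ j, Star.star (Y j i) * Star.star (X l j)
      rw [Quantale.star_iSup]
      exact iSup_congr fun j => InvQuantale.qstar_mul _ _ }

/-- The property of belonging to the centre of `A`: a join-preserving bimodule
endomorphism that is adjointable for the right and left inner products. -/
def IsCen (A : Type u) [InvQuantale A] (f : A → A) : Prop :=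
  (∀ S : Set A, f (sSup S) = ⨆ a ∈ S, f a) ∧
  (∀ a b : A, f (a * b) = f a * b) ∧
  (∀ a b : A, f (a * b) = a * f b) ∧
  Adjointable A f ∧
  (∃ g : A → A, ∀ a b : A, f a * Star.star b = a * Star.star (g b))

/-- The centre of an m-regular involutive quantale. -/
def Cen (A : Type u) [InvQuantale A] : Type u := {f : A → A // IsCen A f}

end Constructions
/-- `M` is weakly projective in `mreg-HMOD_A`. -/
def WeaklyProjHMOD (A : Type u) [InvQuantale A] (M : HObj A) : Prop :=
  ∀ (Y Z : HObj A) (q : Y.carrier → Z.carrier),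
    IsModHom A q → Function.Surjective q →
    ∀ φ : M.carrier → Z.carrier, IsModHom A φ →
      ∃ ψ : M.carrier → Y.carrier, IsModHom A ψ ∧ q ∘ ψ = φ

/-- `M` is weakly projective in `mreg-Hilb_A`. -/
def WeaklyProjHilb (A : Type u) [InvQuantale A] (M : HObj A) : Prop :=
  ∀ (Y Z : HObj A) (q : Y.carrier → Z.carrier),
    Adjointable A q → Function.Surjective q →
    ∀ φ : M.carrier → Z.carrier, Adjointable A φ →
      ∃ ψ : M.carrier → Y.carrier, Adjointable A ψ ∧ q ∘ ψ = φ


section WPHelpers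

variable {A : Type u} [InvQuantale A]

theorem wp_modHom_iSup {M : Type v} {N : Type w} [CompleteLattice M] [CompleteLattice N]
    [QMod A M] [QMod A N] {f : M → N} (hf : IsModHom A f) {ι : Type*} (g : ι → M) :
    f (⨆ i, g i) = ⨆ i, f (g i) := by
  rw [iSup, hf.1, iSup_range]

/-- Adjointable maps into a Hilbert module are module maps. -/
theorem wp_modHom_of_adj {M : Type v} {N : Type w} [CompleteLattice M] [CompleteLattice N]
    [QPreHilb A M] [QHilb A N] {f : M → N} (hf : Adjointable A f) : IsModHom A f := by
  obtain ⟨g, hg⟩ := hf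
  have hg' := hg.symm'
  refine ⟨fun S => ?_, fun m a => ?_⟩
  · apply QHilb.ip_sep (A := A)
    intro p
    have h1 : qip A p (f (sSup S)) = qip A (g p) (sSup S) := (hg' p _).symm
    have h2 : qip A p (⨆ m ∈ S, f m) = ⨆ m ∈ S, qip A p (f m) := by
      rw [qip_iSup_right]
      exact iSup_congr fun m => qip_iSup_right _ _
    refine h1.trans (Eq.trans ?_ h2.symm)
    refine (QPreHilb.ip_sSup _ _).trans ?_
    exact iSup_congr fun m => iSup_congr fun _ => hg' p m
  · apply QHilb.ip_sep (A := A)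
    intro p
    have h1 : qip A p (f (qact m a)) = qip A (g p) (qact m a) := (hg' p _).symm
    refine h1.trans ((QPreHilb.ip_mul _ _ _).symm.trans ?_)
    refine Eq.trans ?_ (QPreHilb.ip_mul _ _ _)
    exact congrArg (· * a) (hg' p m)

theorem wp_star_bot : star (⊥ : A) = ⊥ := by
  have := InvQuantale.star_sSup (∅ : Set A)
  simpa using this

theorem wp_bot_mul (a : A) : (⊥ : A) * a = ⊥ := by
  have := InvQuantale.sSup_mul (∅ : Set A) a
  simpa using this

theorem wp_act_bot {M : Type v} [CompleteLattice M] [QMod A M] (m : M) :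
    qact m (⊥ : A) = ⊥ := by
  have : qact m (sSup (∅ : Set A)) = _ := QMod.act_sSup m (∅ : Set A)
  simpa using this

theorem wp_act_unit {M : Type v} [CompleteLattice M] [QMod A M] (hM : Essential A M)
    {e : A} (he : ∀ a : A, e * a = a ∧ a * e = a) (m : M) : qact m e = m := by
  have h := hM m
  have h2 : qact (sSup {x : M | (∃ (p : M) (a : A), x = qact p a) ∧ x ≤ m}) e
      = sSup {x : M | (∃ (p : M) (a : A), x = qact p a) ∧ x ≤ m} := by
    refine (QMod.sSup_act _ _).trans ?_
    rw [sSup_eq_iSup]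
    refine iSup_congr fun x => iSup_congr fun hx => ?_
    obtain ⟨⟨p, a, rfl⟩, -⟩ := hx
    refine (QMod.act_mul _ _ _).symm.trans ?_
    rw [(he a).2]
  rwa [← h] at h2

open Classical in
/-- The element of `A^J` with value `a` at `j` and bottom elsewhere. -/
noncomputable def wpDelta {J : Type w} (j : J) (a : A) : J → A :=
  fun k => if k = j then a else ⊥

theorem wp_iSup_delta {J : Type w} {L : Type*} [CompleteLattice L] (j : J) (a : A)
    (F : J → A → L) (hF : ∀ k, F k ⊥ = ⊥) : ⨆ k, F k (wpDelta j a k) = F j a := by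
  apply le_antisymm
  · refine iSup_le fun k => ?_
    by_cases h : k = j
    · subst h; simp [wpDelta]
    · simp [wpDelta, h, hF]
  · refine le_trans (le_of_eq ?_) (le_iSup _ j)
    simp [wpDelta]

theorem wp_decomp {J : Type w} {e : A} (he : ∀ a : A, e * a = a ∧ a * e = a) (v : J → A) :
    v = ⨆ j, qact (wpDelta j e) (v j) := by
  funext k
  rw [iSup_apply]
  show v k = ⨆ j, wpDelta j e k * v j
  apply le_antisymm
  · refine le_trans (le_of_eq ?_) (le_iSup _ k)
    simp [wpDelta, (he _).1]
  · refine iSup_le fun j => ?_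
    by_cases h : k = j
    · subst h; simp [wpDelta, (he _).1]
    · simp [wpDelta, h, wp_bot_mul]

/-- The map `A^J → M` determined by a family of elements of `M`. -/
def wpLift {J : Type w} {M : Type v} [CompleteLattice M] [QMod A M] (y : J → M) :
    (J → A) → M := fun v => ⨆ j, qact (y j) (v j)

theorem wpLift_modHom {J : Type w} {M : Type v} [CompleteLattice M] [QMod A M] (y : J → M) :
    IsModHom A (wpLift (A := A) y) := by
  refine ⟨fun S => ?_, fun v a => ?_⟩
  · show (⨆ j, qact (y j) (sSup S j)) = ⨆ v ∈ S, ⨆ j, qact (y j) (v j)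
    calc (⨆ j, qact (y j) (sSup S j))
        = ⨆ j, ⨆ f : S, qact (y j) ((f : J → A) j) := by
          refine iSup_congr fun j => ?_
          rw [sSup_apply, qact_iSup_right]
      _ = ⨆ f : S, ⨆ j, qact (y j) ((f : J → A) j) := iSup_comm
      _ = ⨆ v ∈ S, ⨆ j, qact (y j) (v j) := by rw [iSup_subtype]
  · show (⨆ j, qact (y j) (v j * a)) = qact (⨆ j, qact (y j) (v j)) a
    rw [qact_iSup_left]
    exact iSup_congr fun j => QMod.act_mul _ _ _

theorem wp_ip_act_left {M : Type v} [CompleteLattice M] [QPreHilb A M] (m n : M) (a : A) :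
    qip A (qact m a) n = star a * qip A m n := by
  have h1 : star (qip A n (qact m a)) = qip A (qact m a) n := QPreHilb.star_ip _ _
  have h2 : qip A n m * a = qip A n (qact m a) := QPreHilb.ip_mul _ _ _
  have h3 : star (qip A n m) = qip A m n := QPreHilb.star_ip _ _
  rw [← h1, ← h2, InvQuantale.qstar_mul, h3]

theorem wpLift_adj {J : Type w} {M : Type v} [CompleteLattice M] [QPreHilb A M] (y : J → M) :
    Adjointable A (wpLift (A := A) y) := by
  refine ⟨fun n j => qip A (y j) n, fun v n => ?_⟩
  show qip A (⨆ j, qact (y j) (v j)) n = ⨆ j, star (v j) * qip A (y j) n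
  rw [qip_iSup_left]
  exact iSup_congr fun j => wp_ip_act_left _ _ _

/-- A map out of `A^J` is determined by its values on the basis. -/
theorem wp_lift_eq {J : Type w} {Y : Type*} {Z : Type*} [CompleteLattice Y] [CompleteLattice Z]
    [QMod A Y] [QMod A Z] {e : A} (he : ∀ a : A, e * a = a ∧ a * e = a)
    {q : Y → Z} (hq : IsModHom A q) {φ : (J → A) → Z} (hφ : IsModHom A φ) (y : J → Y)
    (hy : ∀ j, q (y j) = φ (wpDelta j e)) (v : J → A) : q (wpLift y v) = φ v := by
  conv_rhs => rw [wp_decomp he v]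
  rw [wp_modHom_iSup hφ, wpLift, wp_modHom_iSup hq]
  refine iSup_congr fun j => ?_
  rw [hq.2, hφ.2, hy]

/-- The free Hilbert module `A^J` as an object. -/
def wpFree (hu : InvQuantale.IsUnital A) (J : Type u) : HObj A where
  carrier := J → A
  lat := inferInstance
  str :=
    { toQPreHilb := piQPreHilb J A
      ip_sep := by
        obtain ⟨e, he⟩ := hu
        intro m n h
        funext j
        have key : ∀ m : J → A, (⨆ k, star (wpDelta j (star e) k) * m k) = m j := by
          intro m
          rw [wp_iSup_delta j (star e) (fun k a => star a * m k)
            (fun k => by simp [wp_star_bot, wp_bot_mul])]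
          rw [InvQuantale.qstar_star, (he _).1]
        have h1 := h (wpDelta j (star e))
        exact (key m).symm.trans (h1.trans (key n)) }
  ess := by
    obtain ⟨e, he⟩ := hu
    intro m
    apply le_antisymm
    · apply le_sSup
      exact ⟨⟨m, e, funext fun j => (he _).2.symm⟩, le_rfl⟩
    · exact sSup_le fun x hx => hx.2
  sep := by
    obtain ⟨e, he⟩ := hu
    intro m n h
    have h1 : ∀ m : J → A, qact m e = m := fun m => funext fun j => (he _).2
    exact (h1 m).symm.trans ((h e).trans (h1 n))

theorem wp_modHom_comp {M N P : Type*} [CompleteLattice M] [CompleteLattice N]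
    [CompleteLattice P] [QMod A M] [QMod A N] [QMod A P] {f : M → N} {g : N → P}
    (hf : IsModHom A f) (hg : IsModHom A g) : IsModHom A (g ∘ f) := by
  refine ⟨fun S => ?_, fun m a => ?_⟩
  · show g (f (sSup S)) = ⨆ m ∈ S, g (f m)
    rw [sSup_eq_iSup', wp_modHom_iSup hf, wp_modHom_iSup hg, iSup_subtype]
  · show g (f _) = qact (g (f m)) a
    rw [hf.2, hg.2]

theorem wp_adj_comp {M N P : Type*} [CompleteLattice M] [CompleteLattice N]
    [CompleteLattice P] [QPreHilb A M] [QPreHilb A N] [QPreHilb A P] {f : M → N} {g : N → P}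
    (hf : Adjointable A f) (hg : Adjointable A g) : Adjointable A (g ∘ f) := by
  obtain ⟨f', hf⟩ := hf
  obtain ⟨g', hg⟩ := hg
  exact ⟨fun p => f' (g' p), fun m p => (hg (f m) p).trans (hf m (g' p))⟩

theorem wp_lift_surj {M : Type v} [CompleteLattice M] [QMod A M] (hM : Essential A M)
    {e : A} (he : ∀ a : A, e * a = a ∧ a * e = a) :
    Function.Surjective (wpLift (A := A) (fun m : M => m)) := by
  intro m
  refine ⟨wpDelta m e, ?_⟩
  show (⨆ k, qact k (wpDelta m e k)) = m
  rw [wp_iSup_delta m e (fun k a => qact k a) (fun k => wp_act_bot k)]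
  exact wp_act_unit hM he m

end WPHelpers

/-- Over a unital involutive quantale `A`, an object `M` of
`mreg-HMOD_A` (resp. `mreg-Hilb_A`) is weakly projective iff it is a retract of a
free Hilbert `A`-module `A^J`. -/
theorem weakly_projective_iff_retract_of_free (A : Type u) [InvQuantale A]
    (hu : InvQuantale.IsUnital A) (M : HObj A) :
    (WeaklyProjHMOD A M ↔
      ∃ (J : Type u) (i : M.carrier → J → A) (r : (J → A) → M.carrier),
        IsModHom A i ∧ IsModHom A r ∧ r ∘ i = id) ∧
    (WeaklyProjHilb A M ↔
      ∃ (J : Type u) (i : M.carrier → J → A) (r : (J → A) → M.carrier),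
        Adjointable A i ∧ Adjointable A r ∧ r ∘ i = id) := by
  obtain ⟨e, he⟩ := id hu
  refine ⟨⟨fun h => ?_, ?_⟩, ⟨fun h => ?_, ?_⟩⟩
  · obtain ⟨ψ, hψ, hc⟩ := h (wpFree hu M.carrier) M (wpLift (fun m : M.carrier => m))
      (wpLift_modHom _) (wp_lift_surj M.ess he) id ⟨fun S => sSup_eq_iSup, fun _ _ => rfl⟩
    exact ⟨M.carrier, ψ, _, hψ, wpLift_modHom _, hc⟩
  · rintro ⟨J, i, r, hi, hr, hc⟩ Y Z q hq hs φ hφ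
    choose y hy using fun j => hs ((φ ∘ r) (wpDelta j e))
    refine ⟨wpLift y ∘ i, wp_modHom_comp hi (wpLift_modHom y), ?_⟩
    funext m
    have h1 := wp_lift_eq he hq (wp_modHom_comp hr hφ) y hy (i m)
    exact h1.trans (congrArg φ (congrFun hc m))
  · obtain ⟨ψ, hψ, hc⟩ := h (wpFree hu M.carrier) M (wpLift (fun m : M.carrier => m))
      (wpLift_adj _) (wp_lift_surj M.ess he) id ⟨id, fun _ _ => rfl⟩
    exact ⟨M.carrier, ψ, _, hψ, wpLift_adj _, hc⟩
  · rintro ⟨J, i, r, hi, hr, hc⟩ Y Z q hq hs φ hφ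
    choose y hy using fun j => hs ((φ ∘ r) (wpDelta j e))
    refine ⟨wpLift y ∘ i, wp_adj_comp hi (wpLift_adj y), ?_⟩
    funext m
    have h1 := wp_lift_eq he (wp_modHom_of_adj hq)
      (wp_modHom_of_adj (wp_adj_comp hr hφ)) y hy (i m)
    exact h1.trans (congrArg φ (congrFun hc m))
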